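/- There exists a constant C > 0 such that for all n, m ≥ 1, every linear code of matrices Γ: M_n(GF(2)) → GF(2)^m satisfies m ≥ 3n² − C·n^(5/3). -/

import Mathlib

open MvPolynomial in
/-- A polynomial over `GF(2)` that does not vanish at every point is nonzero at a point
whose Hamming weight is at most the degree. -/
theorem MvPolynomial.exists_eval_ne_zero_card_support_le {σ : Type*} [Fintype σ] [DecidableEq σ]
    (f : MvPolynomial σ (ZMod 2)) (hf : ∃ x, eval x f ≠ 0) :
    ∃ x, eval x f ≠ 0 ∧ (Finset.univ.filter fun s => x s ≠ 0).card ≤ f.totalDegree := by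
  obtain ⟨x, hx, hmin⟩ := WellFounded.has_min
    (measure fun x : σ → ZMod 2 => (Finset.univ.filter fun s => x s ≠ 0).card).wf
    {x | eval x f ≠ 0} hf
  refine ⟨x, hx, ?_⟩
  by_contra! hdeg
  let g : MvPolynomial σ (ZMod 2) := f * ∏ s with x s = 0, (1 - X s)
  have hgdeg : g.totalDegree < (Fintype.card (ZMod 2) - 1) * Fintype.card σ := by
    have h₁ : (∏ s with x s = 0, (1 - X s : MvPolynomial σ (ZMod 2))).totalDegree ≤
        (Finset.univ.filter fun s => x s = 0).card := by
      refine (totalDegree_finsetProd _ _).trans ?_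
      refine (Finset.sum_le_card_nsmul _ _ 1 fun s _ => ?_).trans (by simp)
      exact (totalDegree_sub _ _).trans (by simp)
    have h₂ := Finset.card_filter_add_card_filter_not (s := (Finset.univ : Finset σ))
      (fun s => x s = 0)
    have h₃ := totalDegree_mul f (∏ s with x s = 0, (1 - X s))
    simp only [ZMod.card, Finset.card_univ] at h₂ ⊢
    change (f * _).totalDegree < _
    simp only [ne_eq] at hdeg
    omega
  have hsum := MvPolynomial.sum_eval_eq_zero g hgdeg
  rw [Finset.sum_eq_single x] at hsum
  · refine hx ?_
    simp only [g, map_mul, eval_prod, map_sub, map_one, eval_X] at hsum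
    rwa [Finset.prod_eq_one (by simp +contextual), mul_one] at hsum
  · intro y _ hyx
    by_contra hy
    simp only [g, map_mul, eval_prod, mul_eq_zero, not_or, Finset.prod_eq_zero_iff, map_sub,
      map_one, eval_X, Finset.mem_filter, Finset.mem_univ, true_and, not_exists, not_and] at hy
    have h01 : ∀ a : ZMod 2, 1 - a ≠ 0 → a = 0 := by decide
    have h11 : ∀ a b : ZMod 2, a ≠ 0 → b ≠ 0 → a = b := by decide
    refine hmin y hy.1 (Finset.card_lt_card ?_)
    refine (Finset.ssubset_iff_of_subset ?_).2 ?_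
    · intro s hs
      simp only [Finset.mem_filter, Finset.mem_univ, true_and] at hs ⊢
      exact fun h => hs (h01 _ (hy.2 s h))
    · by_contra! hcon
      refine hyx ?_
      funext s
      by_cases hs : x s = 0
      · rw [hs, h01 _ (hy.2 s hs)]
      · have := hcon s (by simpa using hs)
        exact h11 _ _ (by simpa using this) hs
  · simp

/-- The coordinates of an injective linear map contain an information set. -/
theorem LinearMap.exists_information_set {K V ι : Type*} [Field K] [AddCommGroup V] [Module K V]
    [FiniteDimensional K V] [Finite ι] (Γ : V →ₗ[K] ι → K) (hΓ : Function.Injective Γ) :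
    ∃ (S : Set ι) (e : V ≃ₗ[K] S → K), ∀ x i, e x i = Γ x i := by
  classical
  have := Fintype.ofFinite ι
  let v : ι → Module.Dual K V := fun i => LinearMap.proj i ∘ₗ Γ
  obtain ⟨S, -, -, hspan, hli⟩ := exists_linearIndepOn_extension (K := K) (v := v)
    (linearIndepOn_empty K v) (Set.empty_subset (Set.univ : Set ι))
  let F : V →ₗ[K] S → K := LinearMap.pi fun i => v i
  have hF : Function.Injective F := by
    refine (injective_iff_map_eq_zero F).2 fun x hx => ?_
    refine (injective_iff_map_eq_zero Γ).1 hΓ x (funext fun i => ?_)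
    have hle : Submodule.span K (v '' S) ≤ LinearMap.ker (Module.Dual.eval K V x) := by
      rw [Submodule.span_le]
      rintro _ ⟨j, hj, rfl⟩
      exact congrFun hx ⟨j, hj⟩
    exact hle (hspan ⟨i, Set.mem_univ i, rfl⟩)
  have hcard : Module.finrank K V = Module.finrank K (S → K) := by
    refine le_antisymm (LinearMap.finrank_le_finrank_of_injective hF) ?_
    have := hli.fintype_card_le_finrank
    rwa [Subspace.dual_finrank_eq, ← Module.finrank_fintype_fun_eq_card K] at this
  exact ⟨S, LinearEquiv.ofInjectiveOfFinrankEq F hF hcard, fun x i => rfl⟩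

/-- `M_n(GF(2))` contains `2 ^ n` matrices whose pairwise differences are invertible. -/
theorem Matrix.exists_pairwise_det_sub_ne_zero {n k : ℕ} (hn : n ≠ 0) (hk : k ≤ 2 ^ n) :
    ∃ a : Fin k → Matrix (Fin n) (Fin n) (ZMod 2), Pairwise fun i j => (a i - a j).det ≠ 0 := by
  have hfin := GaloisField.finrank 2 hn
  have : Fintype (GaloisField 2 n) := Fintype.ofFinite _
  obtain ⟨g⟩ : Nonempty (Fin k ↪ GaloisField 2 n) := by
    apply Function.Embedding.nonempty_of_card_le
    rwa [Fintype.card_fin, ← Nat.card_eq_fintype_card, GaloisField.card 2 n hn]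
  let b := Module.finBasisOfFinrankEq (ZMod 2) (GaloisField 2 n) hfin
  refine ⟨fun i => Algebra.leftMulMatrix b (g i), fun i j hij => ?_⟩
  have hu : IsUnit (g i - g j) := (sub_ne_zero.2 (g.injective.ne hij)).isUnit
  have hdet := (Matrix.isUnit_iff_isUnit_det _).1 (hu.map (Algebra.leftMulMatrix b))
  rw [map_sub] at hdet
  exact hdet.ne_zero

open MvPolynomial in
theorem Matrix.totalDegree_det_le {n σ R : Type*} [Fintype n] [DecidableEq n] [CommRing R]
    (M : Matrix n n (MvPolynomial σ R)) {d : ℕ} (hM : ∀ i j, (M i j).totalDegree ≤ d) :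
    M.det.totalDegree ≤ Fintype.card n * d := by
  rw [Matrix.det_apply]
  refine totalDegree_finsetSum_le fun τ _ => ?_
  refine (totalDegree_smul_le _ _).trans ((totalDegree_finsetProd _ _).trans ?_)
  exact (Finset.sum_le_card_nsmul _ _ d fun i _ => hM _ _).trans (by simp)

open MvPolynomial in
/-- In any coordinate system of `M_n(GF(2))` there are `k` matrices with pairwise invertible
differences that are jointly supported on few coordinates. -/
theorem Matrix.exists_pairwise_det_sub_ne_zero_sparse {n k : ℕ} (hn : n ≠ 0) (hk : k ≤ 2 ^ n)
    {κ : Type*} [Fintype κ] (e : Matrix (Fin n) (Fin n) (ZMod 2) ≃ₗ[ZMod 2] κ → ZMod 2) :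
    ∃ (a : Fin k → Matrix (Fin n) (Fin n) (ZMod 2)) (T : Finset κ),
      (Pairwise fun i j => (a i - a j).det ≠ 0) ∧ T.card ≤ (k * k - k) * n ∧
      ∀ i, ∀ l ∉ T, e (a i) l = 0 := by
  classical
  let M : Fin k → Matrix (Fin n) (Fin n) (MvPolynomial (Fin k × κ) (ZMod 2)) := fun i =>
    Matrix.of fun p q => ∑ l, X (i, l) * C (e.symm (Pi.single l 1) p q)
  let P : MvPolynomial (Fin k × κ) (ZMod 2) :=
    ∏ ij ∈ (Finset.univ : Finset (Fin k)).offDiag, (M ij.1 - M ij.2).det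
  have hM : ∀ y i, (eval y).mapMatrix (M i) = e.symm fun l => y (i, l) := by
    intro y i
    have h : (fun l => y (i, l)) = ∑ l, y (i, l) • Pi.single l (1 : ZMod 2) := by
      ext l
      simp [Finset.sum_apply, Pi.single_apply]
    rw [h]
    ext p q
    simp [M, Matrix.sum_apply]
  have hP : ∀ y, eval y P ≠ 0 ↔
      Pairwise fun i j => (e.symm (fun l => y (i, l)) - e.symm fun l => y (j, l)).det ≠ 0 := by
    intro y
    simp only [P, eval_prod, RingHom.map_det, map_sub, hM, Finset.prod_ne_zero_iff,
      Finset.mem_offDiag, Finset.mem_univ, true_and, Prod.forall, Pairwise]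
  have hdeg : P.totalDegree ≤ (k * k - k) * n := by
    refine (totalDegree_finsetProd _ _).trans ?_
    refine (Finset.sum_le_card_nsmul _ _ n fun ij _ => ?_).trans
      (by simp [Finset.offDiag_card])
    refine (Matrix.totalDegree_det_le _ (d := 1) fun p q => ?_).trans (by simp)
    have hMdeg : ∀ i, (M i p q).totalDegree ≤ 1 := fun i =>
      totalDegree_finsetSum_le fun l _ => (totalDegree_mul _ _).trans (by simp)
    exact (totalDegree_sub _ _).trans (max_le (hMdeg _) (hMdeg _))
  obtain ⟨a₀, ha₀⟩ := Matrix.exists_pairwise_det_sub_ne_zero hn hk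
  obtain ⟨y, hy, hycard⟩ := MvPolynomial.exists_eval_ne_zero_card_support_le P
    ⟨fun il => e (a₀ il.1) il.2, (hP _).2 (by simpa using ha₀)⟩
  refine ⟨fun i => e.symm fun l => y (i, l),
    (Finset.univ.filter fun s => y s ≠ 0).image Prod.snd, (hP y).1 hy,
    Finset.card_image_le.trans (hycard.trans hdeg), fun i l hl => ?_⟩
  by_contra h
  exact hl (Finset.mem_image.2 ⟨(i, l), by simpa using h, rfl⟩)

/-- Plotkin's bound for binary words supported on a common set `U`. -/
theorem plotkin_bound {ι : Type*} [Fintype ι] {k d : ℕ} (x : Fin k → ι → ZMod 2) (U : Finset ι)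
    (hU : ∀ i, ∀ c ∉ U, x i c = 0)
    (hd : Pairwise fun i j => d ≤ (Finset.univ.filter fun c => x i c ≠ x j c).card) :
    2 * ((k * k - k) * d) ≤ U.card * (k * k) := by
  have hcol : ∀ c, 2 * (∑ i, ∑ j, if x i c ≠ x j c then 1 else 0) ≤ k * k := by
    intro c
    let z := (Finset.univ.filter fun i => x i c = 0).card
    let w := (Finset.univ.filter fun i => ¬ x i c = 0).card
    have hzw : z + w = k := by
      simpa using Finset.card_filter_add_card_filter_not (s := (Finset.univ : Finset (Fin k)))
        (fun i => x i c = 0)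
    have hrow : ∀ i, (∑ j, if x i c ≠ x j c then 1 else 0) = if x i c = 0 then w else z := by
      intro i
      rw [← Finset.card_filter]
      split_ifs with h
      · simp [w, h, eq_comm]
      · congr 1
        ext j
        have h11 : ∀ a b : ZMod 2, a ≠ 0 → (a ≠ b ↔ b = 0) := by decide
        simpa using h11 _ (x j c) h
    simp only [hrow, Finset.sum_ite, Finset.sum_const, smul_eq_mul]
    change 2 * (z * w + w * z) ≤ k * k
    rw [← hzw]
    zify
    nlinarith [sq_nonneg ((z : ℤ) - w)]
  have hlow : (k * k - k) * d ≤
      ∑ ij ∈ (Finset.univ : Finset (Fin k)).offDiag, ∑ c ∈ U,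
        if x ij.1 c ≠ x ij.2 c then 1 else 0 := by
    have hoff : (Finset.univ : Finset (Fin k)).offDiag.card = k * k - k := by
      simp [Finset.offDiag_card]
    rw [← hoff, ← smul_eq_mul]
    refine Finset.card_nsmul_le_sum _ _ _ fun ij hij => ?_
    refine (hd (Finset.mem_offDiag.1 hij).2.2).trans ?_
    rw [← Finset.card_filter]
    refine Finset.card_le_card fun c hc => ?_
    simp only [Finset.mem_filter, Finset.mem_univ, true_and] at hc ⊢
    refine ⟨?_, hc⟩
    by_contra hcU
    exact hc (by rw [hU _ c hcU, hU _ c hcU])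
  calc 2 * ((k * k - k) * d)
      ≤ 2 * ∑ ij : Fin k × Fin k, ∑ c ∈ U, if x ij.1 c ≠ x ij.2 c then 1 else 0 :=
        Nat.mul_le_mul_left _ (hlow.trans
          (Finset.sum_le_sum_of_subset (Finset.subset_univ _)))
    _ = ∑ c ∈ U, 2 * ∑ i, ∑ j, if x i c ≠ x j c then 1 else 0 := by
        rw [Finset.sum_comm, Finset.mul_sum]
        simp only [Fintype.sum_prod_type]
    _ ≤ U.card * (k * k) := by
        simpa using Finset.sum_le_card_nsmul U _ (k * k) fun c _ => hcol c

/-- The Plotkin estimate for linear codes of matrices, using `k` codewords. -/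
theorem linear_code_of_matrices_plotkin {n m k : ℕ} (hn : n ≠ 0) (hk : k ≤ 2 ^ n)
    (Γ : Matrix (Fin n) (Fin n) (ZMod 2) →ₗ[ZMod 2] (Fin m → ZMod 2))
    (hΓ : ∀ a : Matrix (Fin n) (Fin n) (ZMod 2),
      n * a.rank ≤ (Finset.univ.filter fun i => Γ a i ≠ 0).card) :
    2 * ((k * k - k) * (n * n)) + n * n * (k * k) ≤ (m + (k * k - k) * n) * (k * k) := by
  classical
  have hinj : Function.Injective Γ := by
    refine (injective_iff_map_eq_zero Γ).2 fun a ha => ?_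
    have := hΓ a
    simp only [ha, Pi.zero_apply, ne_eq, not_true_eq_false, Finset.filter_false,
      Finset.card_empty, Nat.le_zero, mul_eq_zero, hn, false_or] at this
    rwa [Matrix.rank, Submodule.finrank_eq_zero, LinearMap.range_eq_bot, ← Matrix.toLin'_apply',
      LinearEquiv.map_eq_zero_iff] at this
  obtain ⟨S, e, he⟩ := LinearMap.exists_information_set Γ hinj
  obtain ⟨a, T, hdet, hT, hsupp⟩ := Matrix.exists_pairwise_det_sub_ne_zero_sparse hn hk e
  have hS : S.toFinset.card = n * n := by
    have := e.finrank_eq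
    simp only [Module.finrank_matrix, Fintype.card_fin, Module.finrank_self, mul_one,
      Module.finrank_fintype_fun_eq_card] at this
    rw [Set.toFinset_card, this]
  have hplot := plotkin_bound (d := n * n) (fun i => Γ (a i))
    (S.toFinsetᶜ ∪ T.map (Function.Embedding.subtype _)) (fun i c hc => ?_) (fun i j hij => ?_)
  · have hcard : (S.toFinsetᶜ ∪ T.map (Function.Embedding.subtype _)).card + n * n ≤
        m + (k * k - k) * n := by
      have h₁ := Finset.card_union_le S.toFinsetᶜ (T.map (Function.Embedding.subtype (· ∈ S)))
      have h₂ := Finset.card_compl_add_card S.toFinset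
      rw [Finset.card_map] at h₁
      rw [Fintype.card_fin, hS] at h₂
      omega
    calc _ ≤ _ := Nat.add_le_add_right hplot _
      _ = _ := (Nat.add_mul _ _ _).symm
      _ ≤ _ := Nat.mul_le_mul_right _ hcard
  · simp only [Finset.mem_union, Finset.mem_compl, Set.mem_toFinset, Finset.mem_map, not_or,
      not_not] at hc
    rw [← he (a i) ⟨c, hc.1⟩]
    exact hsupp i _ fun h => hc.2 ⟨_, h, rfl⟩
  · have hrank : (a i - a j).rank = n := by
      simpa using Matrix.rank_of_isUnit _
        ((Matrix.isUnit_iff_isUnit_det _).2 (hdet hij).isUnit)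
    have := hΓ (a i - a j)
    rw [hrank] at this
    simpa [sub_eq_zero] using this

/-- Every linear code of matrices Γ : M_n(GF(2)) → GF(2)^m
(a linear map with weight(Γ a) ≥ n·rank(a) for all a) satisfies
m ≥ 3n² − C·n^(5/3) for some absolute constant C > 0. -/
theorem linear_code_of_matrices_lower_bound :
    ∃ C : ℝ, 0 < C ∧ ∀ n m : ℕ, 1 ≤ n → 1 ≤ m →
      ∀ Γ : Matrix (Fin n) (Fin n) (ZMod 2) →ₗ[ZMod 2] (Fin m → ZMod 2),
      (∀ a : Matrix (Fin n) (Fin n) (ZMod 2),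
        n * a.rank ≤ (Finset.univ.filter fun i => Γ a i ≠ 0).card) →
      (m : ℝ) ≥ 3 * (n : ℝ) ^ 2 - C * (n : ℝ) ^ ((5 : ℝ) / 3) := by
  refine ⟨4, by norm_num, fun n m hn _ Γ hΓ => ?_⟩
  obtain ⟨t, ht1, htn, ht5⟩ : ∃ t : ℝ, 1 ≤ t ∧ (n : ℝ) = t ^ 3 ∧
      (n : ℝ) ^ ((5 : ℝ) / 3) = t ^ 5 := by
    have hn0 : (0 : ℝ) ≤ n := Nat.cast_nonneg n
    refine ⟨(n : ℝ) ^ ((1 : ℝ) / 3), Real.one_le_rpow (by exact_mod_cast hn) (by norm_num), ?_, ?_⟩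
    · rw [← Real.rpow_natCast, ← Real.rpow_mul hn0]
      norm_num
    · rw [← Real.rpow_natCast, ← Real.rpow_mul hn0]
      norm_num
  have ht0 : 0 < t := by linarith
  let k := ⌈t⌉₊
  have hk_ge : t ≤ k := Nat.le_ceil t
  have hk_lt : (k : ℝ) < t + 1 := Nat.ceil_lt_add_one ht0.le
  have hkn : k ≤ n := Nat.ceil_le.2 (htn ▸ le_self_pow₀ ht1 (by norm_num))
  have hplot := linear_code_of_matrices_plotkin (Nat.pos_iff_ne_zero.1 hn)
    (hkn.trans Nat.lt_two_pow_self.le) Γ hΓ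
  have hcast : ((k * k - k : ℕ) : ℝ) = k * k - k := by
    rw [Nat.cast_sub (Nat.le_mul_self k)]
    push_cast
    ring
  have hplot' : 2 * (((k : ℝ) * k - k) * (n * n)) + n * n * (k * k) ≤
      (m + (k * k - k) * n) * (k * k) := by
    rw [← hcast]
    exact_mod_cast hplot
  rw [ht5]
  rw [htn] at hplot' ⊢
  have hk0 : (0 : ℝ) < k := ht0.trans_le hk_ge
  have hdiv : 3 * (t ^ 3) ^ 2 * k - 2 * (t ^ 3) ^ 2 ≤ (m + (k * k - k) * t ^ 3) * k := by
    refine le_of_mul_le_mul_right ?_ hk0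
    linarith
  have hkk : (k : ℝ) * k - k ≤ 2 * t ^ 2 := by nlinarith
  have h₁ : ((k : ℝ) * k - k) * t ^ 3 ≤ 2 * t ^ 5 :=
    (mul_le_mul_of_nonneg_right hkk (by positivity)).trans_eq (by ring)
  have h₂ : 2 * (t ^ 3) ^ 2 ≤ 2 * t ^ 5 * k :=
    (mul_le_mul_of_nonneg_left hk_ge (by positivity : 0 ≤ 2 * t ^ 5)).trans' (by ring_nf; rfl)
  refine le_of_mul_le_mul_right ?_ hk0
  have h₃ := mul_le_mul_of_nonneg_right h₁ hk0.le
  linarith
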